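/- For every m ≥ 1 and every σ ∈ Σ_m: S_1(σ) = 0 if and only if σ is the identity permutation. -/

import Mathlib

open Equiv

/-- The `j`-th face of a permutation of `Fin (n+1)`: delete the entry `σ j` from the
one-line notation and decrease by one every remaining entry exceeding `σ j`. -/
def permFace {n : ℕ} (σ : Equiv.Perm (Fin (n + 1))) (j : Fin (n + 1)) :
    Equiv.Perm (Fin n) :=
  (finSuccAboveEquiv j).trans
    ((σ.subtypeEquiv (fun a => (σ.injective.ne_iff (x := a) (y := j)).symm)).trans
      (finSuccAboveEquiv (σ j)).symm)

/-- The hat `σ̂ ∈ Σ_{n+1}` of `σ ∈ Σ_n`: `σ̂ 0 = 0` and `σ̂ (j+1) = σ j + 1`. -/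
def permHat {n : ℕ} (σ : Equiv.Perm (Fin n)) : Equiv.Perm (Fin (n + 1)) :=
  (finSuccEquiv n).symm.permCongr σ.optionCongr

/-- The alternating-sum boundary map `∂ : ℤΣ_{n+1} → ℤΣ_n`. -/
def permBdry (n : ℕ) :
    FreeAbelianGroup (Equiv.Perm (Fin (n + 1))) →+ FreeAbelianGroup (Equiv.Perm (Fin n)) :=
  FreeAbelianGroup.lift fun σ =>
    ∑ j : Fin (n + 1), (-1 : ℤ) ^ (j : ℕ) • FreeAbelianGroup.of (permFace σ j)

/-- The linear extension `D : ℤΣ_n → ℤΣ_{n+1}` of the hat operation. -/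
def permHatMap (n : ℕ) :
    FreeAbelianGroup (Equiv.Perm (Fin n)) →+ FreeAbelianGroup (Equiv.Perm (Fin (n + 1))) :=
  FreeAbelianGroup.lift fun σ => FreeAbelianGroup.of (permHat σ)

/-- The number of orbits (cycles, counting fixed points) of a permutation of `Fin m`. -/
def permCyc {m : ℕ} (π : Equiv.Perm (Fin m)) : ℕ :=
  π.cycleType.card + (Finset.univ.filter fun x => π x = x).card

/-- The genus `S_2(σ) = (m − Cyc(c_m σ⁻¹ c_m⁻¹ σ))/2` of `σ ∈ Σ_m`. -/
def permS2 {m : ℕ} (σ : Equiv.Perm (Fin m)) : ℕ :=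
  (m - permCyc (finRotate m * σ⁻¹ * (finRotate m)⁻¹ * σ)) / 2

/-- The genus `S_1(σ) = ((m+1) − Cyc(c_{m+1} σ̂⁻¹ c_{m+1}⁻¹ σ̂))/2` of `σ ∈ Σ_m`. -/
def permS1 {m : ℕ} (σ : Equiv.Perm (Fin m)) : ℕ :=
  ((m + 1) -
    permCyc (finRotate (m + 1) * (permHat σ)⁻¹ * (finRotate (m + 1))⁻¹ * permHat σ)) / 2

theorem permCyc_add_sum_cycleType {m : ℕ} (π : Equiv.Perm (Fin m)) :
    permCyc π + π.cycleType.sum = π.cycleType.card + m := by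
  have h := Finset.card_filter_add_card_filter_not (s := Finset.univ) fun x : Fin m => π x = x
  rw [Finset.card_univ, Fintype.card_fin] at h
  have hs : (Finset.univ.filter fun x => ¬ π x = x) = π.support := by
    ext x
    simp
  rw [hs] at h
  rw [permCyc, Equiv.Perm.sum_cycleType]
  omega

/-- An even permutation with at least `m - 1` orbits is trivial. -/
theorem eq_one_of_sub_permCyc_div_two_eq_zero {m : ℕ} {π : Equiv.Perm (Fin m)}
    (hsign : Equiv.Perm.sign π = 1) (h : (m - permCyc π) / 2 = 0) : π = 1 := by
  have hcyc := permCyc_add_sum_cycleType π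
  have hle : π.cycleType.card * 2 ≤ π.cycleType.sum := by
    rw [← smul_eq_mul]
    exact Multiset.card_nsmul_le_sum fun x hx => Equiv.Perm.two_le_of_mem_cycleType hx
  have heven : Even (π.cycleType.sum + π.cycleType.card) := by
    rw [Equiv.Perm.sign_of_cycleType] at hsign
    by_contra hodd
    rw [Nat.not_even_iff_odd] at hodd
    rw [hodd.neg_one_pow] at hsign
    exact absurd hsign (by decide)
  obtain ⟨k, hk⟩ := heven
  rw [← Equiv.Perm.cycleType_eq_zero, ← Multiset.card_eq_zero]
  omega

theorem permCyc_one (m : ℕ) : permCyc (1 : Equiv.Perm (Fin m)) = m := by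
  simp [permCyc]

theorem permHat_zero {n : ℕ} (σ : Equiv.Perm (Fin n)) : permHat σ 0 = 0 := by
  simp [permHat]

theorem permHat_succ {n : ℕ} (σ : Equiv.Perm (Fin n)) (j : Fin n) :
    permHat σ j.succ = (σ j).succ := by
  simp [permHat]

theorem permHat_one (n : ℕ) : permHat (1 : Equiv.Perm (Fin n)) = 1 := by
  ext j
  refine Fin.cases ?_ (fun i => ?_) j
  · simp [permHat_zero]
  · simp [permHat_succ]

theorem eq_one_of_permHat_eq_one {n : ℕ} {σ : Equiv.Perm (Fin n)} (h : permHat σ = 1) :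
    σ = 1 := by
  ext j
  have hj := permHat_succ σ j
  rw [h, Equiv.Perm.one_apply, Fin.succ_inj] at hj
  rw [← hj, Equiv.Perm.one_apply]

/-- A permutation fixing `0` and commuting with the rotation is trivial. -/
theorem eq_one_of_commute_finRotate {n : ℕ} {τ : Equiv.Perm (Fin (n + 1))} (h0 : τ 0 = 0)
    (h : Commute τ (finRotate (n + 1))) : τ = 1 := by
  refine Equiv.ext fun j => ?_
  induction j using Fin.induction with
  | zero => exact h0
  | succ i ih =>
    have hi := Equiv.congr_fun h.eq i.castSucc
    rw [Equiv.Perm.mul_apply, Equiv.Perm.mul_apply, ih, Equiv.Perm.one_apply,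
      finRotate_apply, Fin.coeSucc_eq_succ] at hi
    exact hi

/-- For every `m ≥ 1` and every `σ ∈ Σ_m`, one has `S_1 σ = 0` iff `σ` is
the identity permutation. -/
theorem genus1_eq_zero_iff (m : ℕ) (hm : 1 ≤ m) (σ : Equiv.Perm (Fin m)) :
    permS1 σ = 0 ↔ σ = 1 := by
  constructor
  · intro h
    have hsign : Equiv.Perm.sign (finRotate (m + 1) * (permHat σ)⁻¹ * (finRotate (m + 1))⁻¹ *
        permHat σ) = 1 := by
      rw [map_mul, map_mul, map_mul, map_inv, map_inv, mul_right_comm _ _⁻¹ _⁻¹, mul_inv_cancel,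
        one_mul, inv_mul_cancel]
    have hone := eq_one_of_sub_permCyc_div_two_eq_zero hsign h
    refine eq_one_of_permHat_eq_one (eq_one_of_commute_finRotate (permHat_zero σ) ?_)
    rw [← Commute.inv_left_iff]
    have hcomm : finRotate (m + 1) * (permHat σ)⁻¹ = (permHat σ)⁻¹ * finRotate (m + 1) := by
      rw [mul_assoc, mul_eq_one_iff_eq_inv, mul_inv_rev, inv_inv] at hone
      exact hone
    exact hcomm.symm
  · rintro rfl
    simp [permS1, permHat_one, permCyc_one]
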